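/- Suppose the initial queue satisfies −V·P_max − C_dis ≤ Q(0) ≤ B̄_max − B̄_min − V·P_max − C_dis. Then for all t ∈ ℕ, the virtual queue remains within these bounds: −V·P_max − C_dis ≤ Q(t) ≤ B̄_max − B̄_min − V·P_max − C_dis. -/

import Mathlib

/-- Under the online algorithm, the virtual queue remains
within its bounds for all time. -/
theorem virtual_queue_bounds
    (Pmax Cchar Cdis Bminbar Bmaxbar V : ℝ)
    (hPmax : 0 < Pmax) (hCchar : 0 ≤ Cchar) (hCdis : 0 ≤ Cdis)
    (hV0 : 0 < V)
    (hVmax : V ≤ (Bmaxbar - Bminbar - Cdis - Cchar) / Pmax)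
    (Gb Rb Be P Q : ℕ → ℝ)
    (hGb : ∀ t : ℕ, 0 ≤ Gb t) (hRb : ∀ t : ℕ, 0 ≤ Rb t)
    (hchar0 : ∀ t : ℕ, 0 ≤ Gb t + Rb t)
    (hchar : ∀ t : ℕ, Gb t + Rb t ≤ Cchar)
    (hBe0 : ∀ t : ℕ, 0 ≤ Be t) (hBe : ∀ t : ℕ, Be t ≤ Cdis)
    (hP0 : ∀ t : ℕ, 0 ≤ P t) (hPm : ∀ t : ℕ, P t ≤ Pmax)
    (hQ : ∀ t : ℕ, Q (t + 1) = Q t + Gb t + Rb t - Be t)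
    (halg1 : ∀ t : ℕ, Q t + V * P t ≤ 0 → Be t = 0)
    (halg2 : ∀ t : ℕ, 0 < Q t → Gb t = 0 ∧ Rb t = 0)
    (hQ0lb : -(V * Pmax) - Cdis ≤ Q 0)
    (hQ0ub : Q 0 ≤ Bmaxbar - Bminbar - V * Pmax - Cdis) :
    ∀ t : ℕ, -(V * Pmax) - Cdis ≤ Q t ∧
      Q t ≤ Bmaxbar - Bminbar - V * Pmax - Cdis := by
  have hV : V * Pmax ≤ Bmaxbar - Bminbar - Cdis - Cchar := (le_div_iff₀ hPmax).mp hVmax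
  intro t
  induction t with
  | zero => exact ⟨hQ0lb, hQ0ub⟩
  | succ t ih =>
    obtain ⟨hlb, hub⟩ := ih
    rw [hQ t]
    constructor
    · rcases le_or_gt (Q t + V * P t) 0 with h | h
      · linarith [halg1 t h, hchar0 t]
      · linarith [hBe t, hchar0 t, mul_le_mul_of_nonneg_left (hPm t) hV0.le]
    · rcases le_or_gt (Q t) 0 with h | h
      · linarith [hchar t, hBe0 t]
      · obtain ⟨hG, hR⟩ := halg2 t h
        linarith [hBe0 t]
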